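/- arXiv:1910.08744 — 2 statements merged into one kernel-verified Lean document; each statement's English description precedes it below -/
import Mathlib

section
/- Assume A2. Then for every vector α ∈ ℝ^D the following equivalence holds: the semi-infinite constraint ∑_{i : l_i ≤ c ≤ u_i} α_i − c ≥ 0 holds for every c ∈ [l, u] if and only if the finitely many constraints ∑_{i ∈ D(j)} α_i − U_j ≥ 0 hold for every j ∈ {1,…,W}. -/
open Set
open scoped Classical

noncomputable section

/-- A predicate on `Fin (n + 1)` that holds at `0` and fails somewhere fails right after an
index at which it holds. -/
theorem exists_castSucc_and_not_succ {n : ℕ} {P : Fin (n + 1) → Prop} (h0 : P 0)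
    {k : Fin (n + 1)} (hk : ¬ P k) : ∃ j : Fin n, P j.castSucc ∧ ¬ P j.succ := by
  by_contra! h
  exact hk (Fin.induction h0 h k)

/-- A strictly monotone sequence takes no value strictly between two consecutive terms. -/
theorem StrictMono.le_castSucc_of_lt_succ {β : Type*} [LinearOrder β] {n : ℕ}
    {e : Fin (n + 1) → β} (he : StrictMono e) {y : β} (hy : y ∈ range e) {j : Fin n}
    (h : y < e j.succ) : y ≤ e j.castSucc := by
  obtain ⟨k, rfl⟩ := hy
  exact he.monotone (Fin.le_castSucc_iff.2 (he.lt_iff_lt.1 h))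

theorem StrictMono.succ_le_of_castSucc_lt {β : Type*} [LinearOrder β] {n : ℕ}
    {e : Fin (n + 1) → β} (he : StrictMono e) {y : β} (hy : y ∈ range e) {j : Fin n}
    (h : e j.castSucc < y) : e j.succ ≤ y :=
  le_of_not_gt fun h' => (he.le_castSucc_of_lt_succ hy h').not_gt h

/-- Under Assumption A2, the semi-infinite constraint
`∑_{i : l_i ≤ c ≤ u_i} α_i − c ≥ 0` for every `c ∈ [l, u]` is equivalent to the finitely many
constraints `∑_{i ∈ D(j)} α_i − U_j ≥ 0` for every elementary subinterval `j`. -/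
theorem stmt_3 (D W : ℕ) (hD : 0 < D)
    (l u : ℝ) (hl0 : 0 ≤ l) (hlu : l ≤ u)
    (lo hi : Fin D → ℝ)
    (hllo : ∀ i, l ≤ lo i) (hlohi : ∀ i, lo i ≤ hi i) (hhiu : ∀ i, hi i ≤ u)
    (hloD : lo ⟨D - 1, Nat.sub_lt hD one_pos⟩ = l)
    (hhiD : hi ⟨D - 1, Nat.sub_lt hD one_pos⟩ = u)
    (e : Fin (W + 1) → ℝ) (hemono : StrictMono e)
    (herange : Set.range e = Set.range lo ∪ Set.range hi)
    (hA2 : ∀ i₁ i₂ : Fin D, lo i₁ ≠ hi i₂)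
    (α : Fin D → ℝ) :
    (∀ c ∈ Icc l u,
        0 ≤ (∑ i ∈ Finset.univ.filter (fun i : Fin D => lo i ≤ c ∧ c ≤ hi i), α i) - c) ↔
      (∀ j : Fin W,
        0 ≤ (∑ i ∈ Finset.univ.filter
            (fun i : Fin D => Icc (e j.castSucc) (e j.succ) ⊆ Icc (lo i) (hi i)), α i)
          - e j.succ) := by
  have hlo_mem (i : Fin D) : lo i ∈ range e := herange ▸ Or.inl (mem_range_self i)
  have hhi_mem (i : Fin D) : hi i ∈ range e := herange ▸ Or.inr (mem_range_self i)
  have hlt (j : Fin W) : e j.castSucc < e j.succ := hemono j.castSucc_lt_succ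
  have hsub (j : Fin W) (i : Fin D) : Icc (e j.castSucc) (e j.succ) ⊆ Icc (lo i) (hi i) ↔
      lo i ≤ e j.castSucc ∧ e j.succ ≤ hi i := Icc_subset_Icc_iff (hlt j).le
  simp only [hsub]
  constructor
  · intro h j
    have hmem (m : Fin (W + 1)) : e m ∈ Icc l u := by
      have hm : e m ∈ range lo ∪ range hi := herange ▸ mem_range_self m
      rcases hm with ⟨i, hi'⟩ | ⟨i, hi'⟩ <;> rw [← hi']
      · exact ⟨hllo i, (hlohi i).trans (hhiu i)⟩
      · exact ⟨(hllo i).trans (hlohi i), hhiu i⟩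
    rw [sub_nonneg]
    refine le_of_forall_lt_imp_le_of_dense fun c hc => ?_
    obtain ⟨d, hd, hdU⟩ := exists_between (max_lt hc (hlt j))
    obtain ⟨hcd, hLd⟩ := max_lt_iff.1 hd
    have hsum := h d ⟨(hmem _).1.trans hLd.le, hdU.le.trans (hmem _).2⟩
    have hfilter (i : Fin D) : lo i ≤ d ∧ d ≤ hi i ↔
        lo i ≤ e j.castSucc ∧ e j.succ ≤ hi i :=
      ⟨fun hi' => ⟨hemono.le_castSucc_of_lt_succ (hlo_mem i) (hi'.1.trans_lt hdU),
        hemono.succ_le_of_castSucc_lt (hhi_mem i) (hLd.trans_le hi'.2)⟩,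
        fun hi' => ⟨hi'.1.trans hLd.le, hdU.le.trans hi'.2⟩⟩
    simp only [hfilter] at hsum
    exact hcd.le.trans (sub_nonneg.1 hsum)
  · intro h c hc
    obtain ⟨kl, hkl⟩ : l ∈ range e := hloD ▸ hlo_mem _
    obtain ⟨ku, hku⟩ : u ∈ range e := hhiD ▸ hhi_mem _
    have h0l : e 0 ≤ l := hkl ▸ hemono.monotone (Fin.zero_le kl)
    obtain ⟨j, hcU, hfilter⟩ : ∃ j : Fin W, c ≤ e j.succ ∧ ∀ i, (lo i ≤ c ∧ c ≤ hi i ↔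
        lo i ≤ e j.castSucc ∧ e j.succ ≤ hi i) := by
      by_cases hchi : c ∈ range hi
      · obtain ⟨i₀, hi₀⟩ := hchi
        have hlc : l < c := hc.1.lt_of_ne (hloD ▸ hi₀ ▸ hA2 _ i₀)
        obtain ⟨j, hL, hU⟩ := exists_castSucc_and_not_succ (P := fun m => e m < c)
          (h0l.trans_lt hlc) (k := ku) (by rw [hku]; exact hc.2.not_gt)
        have hU := not_lt.1 hU
        refine ⟨j, hU, fun i => ⟨fun hi' => ⟨?_, ?_⟩, fun hi' =>
          ⟨hi'.1.trans hL.le, hU.trans hi'.2⟩⟩⟩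
        · exact hemono.le_castSucc_of_lt_succ (hlo_mem i)
            ((hi'.1.lt_of_ne (hi₀ ▸ hA2 i i₀)).trans_le hU)
        · exact hemono.succ_le_of_castSucc_lt (hhi_mem i) (hL.trans_le hi'.2)
      · have hcu : c < u := hc.2.lt_of_ne fun hcu => hchi ⟨_, hhiD.trans hcu.symm⟩
        obtain ⟨j, hL, hU⟩ := exists_castSucc_and_not_succ (P := fun m => e m ≤ c)
          (h0l.trans hc.1) (k := ku) (by rw [hku]; exact hcu.not_ge)
        have hU := not_le.1 hU
        refine ⟨j, hU.le, fun i => ⟨fun hi' => ⟨?_, ?_⟩, fun hi' =>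
          ⟨hi'.1.trans hL, hU.le.trans hi'.2⟩⟩⟩
        · exact hemono.le_castSucc_of_lt_succ (hlo_mem i) (hi'.1.trans_lt hU)
        · exact hemono.succ_le_of_castSucc_lt (hhi_mem i)
            (hL.trans_lt (hi'.2.lt_of_ne fun hci => hchi ⟨i, hci.symm⟩))
    simp only [hfilter]
    exact (h j).trans (sub_le_sub_left hcU _)
end
end

section
/- Assume that for every a ∈ A the set Q̃_a is nonempty and both c^min_a := inf_{Q_a ∈ Q̃_a} E_{Q_a}[c_a] and c^max_a := sup_{Q_a ∈ Q̃_a} E_{Q_a}[c_a] are attained by some measures in Q̃_a, and assume S ≠ ∅. Then min_{y ∈ Y} sup_{Q ∈ Q} E_Q[∑_{a∈A} c_a y_a] equals the optimal value of the mixed-integer program: minimize bᵀλ + (c^max)ᵀν − (c^min)ᵀμ over y ∈ Y, λ ∈ ℝ^{D₀}, μ ∈ ℝ^A, ν ∈ ℝ^A subject to λ ≥ 0, μ ≥ 0, ν ≥ 0, and −y + Bᵀλ + ν = μ; moreover this minimum is attained. -/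
open MeasureTheory Set

noncomputable section

/-- The quantile ambiguity set `Q̃_a` for a single arc. -/
def ambSet (D : ℕ) (lo hi ql qh : Fin D → ℝ) : Set (Measure ℝ) :=
  {Q | IsProbabilityMeasure Q ∧ ∀ i : Fin D,
    ql i ≤ (Q (Icc (lo i) (hi i))).toReal ∧ (Q (Icc (lo i) (hi i))).toReal ≤ qh i}

/-- The best-case expected arc cost `c^min_a`. -/
def cmin (D : ℕ) (lo hi ql qh : Fin D → ℝ) : ℝ :=
  sInf ((fun Q : Measure ℝ => ∫ x, x ∂Q) '' ambSet D lo hi ql qh)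

/-- The worst-case expected arc cost `c^max_a`. -/
def cmax (D : ℕ) (lo hi ql qh : Fin D → ℝ) : ℝ :=
  sSup ((fun Q : Measure ℝ => ∫ x, x ∂Q) '' ambSet D lo hi ql qh)

/-- The mean of the marginal of `Q` at coordinate `a`. -/
def margMean {A : Type*} [Fintype A] (Q : Measure (A → ℝ)) (a : A) : ℝ :=
  ∫ x, x ∂(Q.map (fun c => c a))

/-- The full ambiguity set `Q` with linear expectation constraints `B m(Q) ≤ b`. -/
def ambJoint {A : Type*} [Fintype A] (D : A → ℕ) (lo hi ql qh : (a : A) → Fin (D a) → ℝ)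
    (D0 : ℕ) (B : Fin D0 → A → ℝ) (b : Fin D0 → ℝ) : Set (Measure (A → ℝ)) :=
  {Q | IsProbabilityMeasure Q ∧
    (∀ a : A, Q.map (fun c => c a) ∈ ambSet (D a) (lo a) (hi a) (ql a) (qh a)) ∧
    ∀ d : Fin D0, (∑ a, B d a * margMean Q a) ≤ b d}

/-- The polyhedral uncertainty set `S`. -/
def polyS {A : Type*} [Fintype A] (D : A → ℕ) (lo hi ql qh : (a : A) → Fin (D a) → ℝ)
    (D0 : ℕ) (B : Fin D0 → A → ℝ) (b : Fin D0 → ℝ) : Set (A → ℝ) :=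
  {cbar | (∀ a : A, cmin (D a) (lo a) (hi a) (ql a) (qh a) ≤ cbar a ∧
      cbar a ≤ cmax (D a) (lo a) (hi a) (ql a) (qh a)) ∧
    ∀ d : Fin D0, (∑ a, B d a * cbar a) ≤ b d}

/-- Feasibility for the MIP: `λ, μ, ν ≥ 0` and `−y + Bᵀλ + ν = μ`. -/
def mipFeas {A : Type*} [Fintype A] (D0 : ℕ) (B : Fin D0 → A → ℝ)
    (y : A → ℝ) (lam : Fin D0 → ℝ) (mu nu : A → ℝ) : Prop :=
  (∀ d, 0 ≤ lam d) ∧ (∀ a, 0 ≤ mu a) ∧ (∀ a, 0 ≤ nu a) ∧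
    ∀ a, -(y a) + (∑ d, B d a * lam d) + nu a = mu a

/-- **Farkas' lemma** for finitely many linear functionals on a real vector space. -/
theorem exists_nonneg_eq_sum_smul_of_forall_nonneg {ι V : Type*} [AddCommGroup V] [Module ℝ V]
    (s : Finset ι) (f : ι → V →ₗ[ℝ] ℝ) (g : V →ₗ[ℝ] ℝ)
    (h : ∀ x, (∀ i ∈ s, 0 ≤ f i x) → 0 ≤ g x) :
    ∃ w : ι → ℝ, (∀ i, 0 ≤ w i) ∧ ∀ x, g x = ∑ i ∈ s, w i * f i x := by
  classical
  induction s using Finset.induction_on generalizing f g with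
  | empty =>
    refine ⟨0, fun _ => le_rfl, fun x => ?_⟩
    have h1 := h x (by simp)
    have h2 := h (-x) (by simp)
    rw [map_neg] at h2
    simp only [Finset.sum_empty]
    linarith
  | insert j s hj ih =>
    by_cases hs : ∀ x, (∀ i ∈ s, 0 ≤ f i x) → 0 ≤ g x
    · obtain ⟨w, hw0, hw⟩ := ih f g hs
      refine ⟨Function.update w j 0, fun i => ?_, fun x => ?_⟩
      · by_cases hi : i = j
        · simp [hi]
        · simp [hi, hw0 i]
      · rw [Finset.sum_insert hj, hw x, Function.update_self, zero_mul, zero_add]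
        refine Finset.sum_congr rfl fun i hi => ?_
        rw [Function.update_of_ne (ne_of_mem_of_not_mem hi hj)]
    · push Not at hs
      obtain ⟨z, hz, hgz⟩ := hs
      have hjz : f j z < 0 := by
        by_contra hcon
        push Not at hcon
        refine absurd (h z fun i hi => ?_) (not_le.2 hgz)
        rcases Finset.mem_insert.1 hi with rfl | hi
        · exact hcon
        · exact hz i hi
      -- The projection onto the kernel of `f j` along `z`.
      let P : V →ₗ[ℝ] V := LinearMap.id - ((f j z)⁻¹ • f j).smulRight z
      have hP : ∀ (k : V →ₗ[ℝ] ℝ) x, k (P x) = k x - (f j z)⁻¹ * f j x * k z := by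
        intro k x
        simp [P]
      obtain ⟨w, hw0, hw⟩ := ih (fun i => f i ∘ₗ P) (g ∘ₗ P) fun x hx => by
        refine h (P x) fun i hi => ?_
        rcases Finset.mem_insert.1 hi with rfl | hi
        · rw [hP]
          have : (f i z)⁻¹ * f i x * f i z = f i x := by
            rw [mul_right_comm, inv_mul_cancel₀ hjz.ne, one_mul]
          linarith
        · exact hx i hi
      have hsum : 0 ≤ ∑ i ∈ s, w i * f i z :=
        Finset.sum_nonneg fun i hi => mul_nonneg (hw0 i) (hz i hi)
      refine ⟨Function.update w j ((f j z)⁻¹ * (g z - ∑ i ∈ s, w i * f i z)),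
        fun i => ?_, fun x => ?_⟩
      · by_cases hi : i = j
        · subst hi
          rw [Function.update_self]
          exact mul_nonneg_of_nonpos_of_nonpos (inv_nonpos.2 hjz.le) (by linarith)
        · simp [hi, hw0 i]
      · have hx := hw x
        simp only [LinearMap.comp_apply, hP, mul_sub, Finset.sum_sub_distrib] at hx
        rw [Finset.sum_insert hj, Function.update_self,
          Finset.sum_congr rfl fun i hi =>
            congrArg (· * f i x) (Function.update_of_ne (ne_of_mem_of_not_mem hi hj) _ w)]
        have : ∑ i ∈ s, w i * ((f j z)⁻¹ * f j x * f i z) =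
            (f j z)⁻¹ * f j x * ∑ i ∈ s, w i * f i z := by
          rw [Finset.mul_sum]
          exact Finset.sum_congr rfl fun i _ => by ring
        rw [this] at hx
        linear_combination hx

/-- Weak duality for a linear program with box constraints `m ≤ c ≤ M` and `B c ≤ b`. -/
theorem sum_mul_le_of_mipFeas {A : Type*} [Fintype A] {D0 : ℕ} {B : Fin D0 → A → ℝ}
    {b : Fin D0 → ℝ} {m M y c : A → ℝ} {lam : Fin D0 → ℝ} {mu nu : A → ℝ}
    (hf : mipFeas D0 B y lam mu nu) (hc : ∀ a, m a ≤ c a ∧ c a ≤ M a)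
    (hB : ∀ d, ∑ a, B d a * c a ≤ b d) :
    ∑ a, c a * y a ≤ ∑ d, b d * lam d + ∑ a, M a * nu a - ∑ a, m a * mu a := by
  obtain ⟨hlam, hmu, hnu, heq⟩ := hf
  have h1 : ∑ a, c a * y a =
      ∑ d, (∑ a, B d a * c a) * lam d + ∑ a, c a * nu a - ∑ a, c a * mu a := by
    simp only [Finset.sum_mul]
    rw [Finset.sum_comm, ← Finset.sum_add_distrib, ← Finset.sum_sub_distrib]
    refine Finset.sum_congr rfl fun a _ => ?_
    rw [← heq a, mul_add, mul_add, Finset.mul_sum,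
      Finset.sum_congr rfl fun d _ => (by ring : c a * (B d a * lam d) = B d a * c a * lam d)]
    ring
  rw [h1]
  gcongr with d _ a _ a _
  · exact hlam d
  · exact hB d
  · exact hnu a
  · exact (hc a).2
  · exact hmu a
  · exact (hc a).1

/-- Strong duality for a linear program with box constraints `m ≤ c ≤ M` and `B c ≤ b`,
in the form: every upper bound on its value is certified by a dual feasible point. -/
theorem exists_mipFeas_le {A : Type*} [Fintype A] {D0 : ℕ} {B : Fin D0 → A → ℝ}
    {b : Fin D0 → ℝ} {m M y : A → ℝ} {t : ℝ}
    (ht : ∀ c : A → ℝ, (∀ a, m a ≤ c a ∧ c a ≤ M a) → (∀ d, ∑ a, B d a * c a ≤ b d) →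
      ∑ a, c a * y a ≤ t) :
    ∃ lam mu nu, mipFeas D0 B y lam mu nu ∧
      ∑ d, b d * lam d + ∑ a, M a * nu a - ∑ a, m a * mu a ≤ t := by
  classical
  -- Homogenize with an extra nonnegative variable and apply Farkas' lemma.
  let X (a : A) : (A → ℝ) × ℝ →ₗ[ℝ] ℝ := LinearMap.proj a ∘ₗ LinearMap.fst ℝ (A → ℝ) ℝ
  let T : (A → ℝ) × ℝ →ₗ[ℝ] ℝ := LinearMap.snd ℝ (A → ℝ) ℝ
  let f : (Unit ⊕ Fin D0) ⊕ (A ⊕ A) → (A → ℝ) × ℝ →ₗ[ℝ] ℝ :=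
    Sum.elim (Sum.elim (fun _ => T) fun d => b d • T - ∑ a, B d a • X a)
      (Sum.elim (fun a => X a - m a • T) fun a => M a • T - X a)
  let g : (A → ℝ) × ℝ →ₗ[ℝ] ℝ := t • T - ∑ a, y a • X a
  obtain ⟨w, hw0, hw⟩ := exists_nonneg_eq_sum_smul_of_forall_nonneg Finset.univ f g (by
    rintro ⟨c, τ⟩ hx
    have hτ : 0 ≤ τ := by simpa [f, T] using hx (.inl (.inl ())) (Finset.mem_univ _)
    have hd : ∀ d, ∑ a, B d a * c a ≤ b d * τ := fun d => by
      simpa [f, T, X] using hx (.inl (.inr d)) (Finset.mem_univ _)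
    have hm : ∀ a, m a * τ ≤ c a := fun a => by
      simpa [f, T, X] using hx (.inr (.inl a)) (Finset.mem_univ _)
    have hM : ∀ a, c a ≤ M a * τ := fun a => by
      simpa [f, T, X] using hx (.inr (.inr a)) (Finset.mem_univ _)
    suffices ∑ a, y a * c a ≤ t * τ by simpa [g, T, X] using this
    rcases hτ.eq_or_lt with rfl | hτ
    · have hc : ∀ a, c a = 0 := fun a => le_antisymm (by simpa using hM a) (by simpa using hm a)
      simp [hc]
    · have := ht (fun a => c a / τ)
        (fun a => ⟨(le_div_iff₀ hτ).2 (hm a), (div_le_iff₀ hτ).2 (hM a)⟩)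
        (fun d => by
          simp only [← mul_div_assoc, ← Finset.sum_div]
          exact (div_le_iff₀ hτ).2 (hd d))
      simp only [div_mul_eq_mul_div, ← Finset.sum_div] at this
      rw [div_le_iff₀ hτ] at this
      simpa only [mul_comm (y _)] using this)
  refine ⟨fun d => w (.inl (.inr d)), fun a => w (.inr (.inl a)), fun a => w (.inr (.inr a)),
    ⟨fun _ => hw0 _, fun _ => hw0 _, fun _ => hw0 _, fun a => ?_⟩, ?_⟩
  · have h := hw (Pi.single a 1, 0)
    simp [f, g, T, X, Pi.single_apply, Fintype.sum_sum_type] at h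
    simp only [mul_comm (B _ a)]
    linarith
  · have h := hw (0, 1)
    simp [f, g, T, X, Fintype.sum_sum_type] at h
    have := hw0 (.inl (.inl ()))
    simp only [mul_comm (b _), mul_comm (M _), mul_comm (m _)]
    linarith

/-- A probability measure in the ambiguity set is concentrated on every interval of lower
quantile bound `1`. -/
theorem ae_mem_Icc_of_mem_ambSet {D : ℕ} {lo hi ql qh : Fin D → ℝ} {Q : Measure ℝ}
    (hQ : Q ∈ ambSet D lo hi ql qh) {i : Fin D} (hi1 : ql i = 1) :
    ∀ᵐ x ∂Q, x ∈ Icc (lo i) (hi i) := by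
  have := hQ.1
  have h1 : (Q (Icc (lo i) (hi i))).toReal = 1 :=
    le_antisymm (by simpa using ENNReal.toReal_mono ENNReal.one_ne_top prob_le_one)
      (hi1 ▸ (hQ.2 i).1)
  exact (mem_ae_iff_prob_eq_one measurableSet_Icc).2 ((ENNReal.toReal_eq_one_iff _).1 h1)

theorem integrable_id_of_mem_ambSet {D : ℕ} {lo hi ql qh : Fin D → ℝ} {Q : Measure ℝ}
    (hQ : Q ∈ ambSet D lo hi ql qh) {i : Fin D} (hi1 : ql i = 1) :
    Integrable (fun x : ℝ => x) Q :=
  have := hQ.1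
  Integrable.of_mem_Icc _ _ aemeasurable_id (ae_mem_Icc_of_mem_ambSet hQ hi1)

theorem integral_mem_Icc_of_mem_ambSet {D : ℕ} {lo hi ql qh : Fin D → ℝ} {Q : Measure ℝ}
    (hQ : Q ∈ ambSet D lo hi ql qh) {i : Fin D} (hi1 : ql i = 1) :
    ∫ x, x ∂Q ∈ Icc (lo i) (hi i) := by
  have := hQ.1
  have h := ae_mem_Icc_of_mem_ambSet hQ hi1
  have hid := integrable_id_of_mem_ambSet hQ hi1
  constructor
  · simpa using integral_mono_ae (integrable_const (lo i)) hid (h.mono fun x hx => hx.1)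
  · simpa using integral_mono_ae hid (integrable_const (hi i)) (h.mono fun x hx => hx.2)

theorem cmin_le_integral_le_cmax {D : ℕ} {lo hi ql qh : Fin D → ℝ} {Q : Measure ℝ}
    (hQ : Q ∈ ambSet D lo hi ql qh) {i : Fin D} (hi1 : ql i = 1) :
    cmin D lo hi ql qh ≤ ∫ x, x ∂Q ∧ ∫ x, x ∂Q ≤ cmax D lo hi ql qh := by
  constructor
  · refine csInf_le ⟨lo i, ?_⟩ (mem_image_of_mem _ hQ)
    rintro _ ⟨R, hR, rfl⟩
    exact (integral_mem_Icc_of_mem_ambSet hR hi1).1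
  · refine le_csSup ⟨hi i, ?_⟩ (mem_image_of_mem _ hQ)
    rintro _ ⟨R, hR, rfl⟩
    exact (integral_mem_Icc_of_mem_ambSet hR hi1).2

/-- The quantile ambiguity set is closed under mixtures. -/
theorem mix_mem_ambSet {D : ℕ} {lo hi ql qh : Fin D → ℝ} {Q R : Measure ℝ}
    (hQ : Q ∈ ambSet D lo hi ql qh) (hR : R ∈ ambSet D lo hi ql qh) {p q : NNReal}
    (hpq : p + q = 1) : p • Q + q • R ∈ ambSet D lo hi ql qh := by
  have := hQ.1
  have := hR.1
  have hpq' : (p : ℝ) + q = 1 := mod_cast hpq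
  refine ⟨⟨?_⟩, fun i => ?_⟩
  · simp only [Measure.coe_add, Measure.coe_nnreal_smul_apply, Pi.add_apply, measure_univ, mul_one]
    exact_mod_cast hpq
  · have h : ((p • Q + q • R) (Icc (lo i) (hi i))).toReal =
        p * (Q (Icc (lo i) (hi i))).toReal + q * (R (Icc (lo i) (hi i))).toReal := by
      rw [Measure.coe_add, Pi.add_apply, Measure.coe_nnreal_smul_apply,
        Measure.coe_nnreal_smul_apply, ENNReal.toReal_add (by finiteness) (by finiteness)]
      simp
    rw [h]
    have h1 := hQ.2 i
    have h2 := hR.2 i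
    constructor
    · calc ql i = p * ql i + q * ql i := by rw [← add_mul, hpq', one_mul]
        _ ≤ _ := by gcongr; exacts [h1.1, h2.1]
    · calc _ ≤ p * qh i + q * qh i := by gcongr; exacts [h1.2, h2.2]
        _ = qh i := by rw [← add_mul, hpq', one_mul]

/-- Every value between `cmin` and `cmax` is the mean of a measure in the ambiguity set, provided
both bounds are attained. -/
theorem exists_mem_ambSet_integral_eq {D : ℕ} {lo hi ql qh : Fin D → ℝ} {i : Fin D}
    (hi1 : ql i = 1)
    (hmin : ∃ Q ∈ ambSet D lo hi ql qh, ∫ x, x ∂Q = cmin D lo hi ql qh)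
    (hmax : ∃ Q ∈ ambSet D lo hi ql qh, ∫ x, x ∂Q = cmax D lo hi ql qh) {c : ℝ}
    (hc : cmin D lo hi ql qh ≤ c ∧ c ≤ cmax D lo hi ql qh) :
    ∃ Q ∈ ambSet D lo hi ql qh, ∫ x, x ∂Q = c := by
  obtain ⟨Q, hQ, hQm⟩ := hmin
  obtain ⟨R, hR, hRm⟩ := hmax
  have hseg : c ∈ segment ℝ (cmin D lo hi ql qh) (cmax D lo hi ql qh) := by
    rw [segment_eq_Icc (hc.1.trans hc.2)]
    exact hc
  obtain ⟨p, q, hp, hq, hpq, rfl⟩ := hseg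
  lift p to NNReal using hp
  lift q to NNReal using hq
  refine ⟨p • Q + q • R, mix_mem_ambSet hQ hR (mod_cast hpq), ?_⟩
  have hidQ := integrable_id_of_mem_ambSet hQ hi1
  have hidR := integrable_id_of_mem_ambSet hR hi1
  rw [integral_add_measure hidQ.smul_measure_nnreal hidR.smul_measure_nnreal,
    integral_smul_nnreal_measure, integral_smul_nnreal_measure, hQm, hRm]
  rfl

/-- The expected costs attained over the joint ambiguity set are the linear costs over `polyS`. -/
theorem image_integral_ambJoint_eq {A : Type*} [Fintype A] {D : A → ℕ}
    {lo hi ql qh : (a : A) → Fin (D a) → ℝ} {i : (a : A) → Fin (D a)}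
    (hi1 : ∀ a, ql a (i a) = 1)
    (hmin : ∀ a, ∃ Q ∈ ambSet (D a) (lo a) (hi a) (ql a) (qh a),
      ∫ x, x ∂Q = cmin (D a) (lo a) (hi a) (ql a) (qh a))
    (hmax : ∀ a, ∃ Q ∈ ambSet (D a) (lo a) (hi a) (ql a) (qh a),
      ∫ x, x ∂Q = cmax (D a) (lo a) (hi a) (ql a) (qh a))
    (D0 : ℕ) (B : Fin D0 → A → ℝ) (b : Fin D0 → ℝ) (y : A → ℝ) :
    (fun Q : Measure (A → ℝ) => ∫ c, ∑ a, c a * y a ∂Q) '' ambJoint D lo hi ql qh D0 B b =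
      (fun c : A → ℝ => ∑ a, c a * y a) '' polyS D lo hi ql qh D0 B b := by
  have hmean : ∀ Q : Measure (A → ℝ),
      (∀ a, Q.map (fun c => c a) ∈ ambSet (D a) (lo a) (hi a) (ql a) (qh a)) →
      ∫ c, ∑ a, c a * y a ∂Q = ∑ a, margMean Q a * y a := by
    intro Q hQ
    have hid : ∀ a, Integrable (fun c : A → ℝ => c a) Q := fun a =>
      (integrable_id_of_mem_ambSet (hQ a) (hi1 a)).comp_measurable (measurable_pi_apply a)
    rw [integral_finsetSum _ fun a _ => (hid a).mul_const _]
    refine Finset.sum_congr rfl fun a _ => ?_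
    rw [integral_mul_const, margMean,
      integral_map (φ := fun c : A → ℝ => c a) (f := fun x : ℝ => x)
        (measurable_pi_apply a).aemeasurable (by fun_prop)]
  apply Subset.antisymm
  · rintro _ ⟨Q, ⟨_, hQ, hB⟩, rfl⟩
    exact ⟨margMean Q, ⟨fun a => cmin_le_integral_le_cmax (hQ a) (hi1 a), hB⟩, (hmean Q hQ).symm⟩
  · rintro _ ⟨c, ⟨hc, hB⟩, rfl⟩
    choose R hR hRc using fun a =>
      exists_mem_ambSet_integral_eq (hi1 a) (hmin a) (hmax a) (hc a)
    have := fun a => (hR a).1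
    have hmap : ∀ a, (Measure.pi R).map (fun c => c a) = R a := fun a =>
      (measurePreserving_eval R a).map_eq
    have hmarg : margMean (Measure.pi R) = c := by
      funext a
      rw [margMean, hmap, hRc]
    have hmem : ∀ a, (Measure.pi R).map (fun c => c a) ∈
        ambSet (D a) (lo a) (hi a) (ql a) (qh a) := fun a => by rw [hmap]; exact hR a
    refine ⟨Measure.pi R, ⟨inferInstance, hmem, by rwa [hmarg]⟩, ?_⟩
    simp only [hmean _ hmem, hmarg]

/-- `min_{y ∈ Y} sup_{Q ∈ Q} E_Q[∑ c_a y_a]` equals the optimal value of the mixed-integer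
program minimizing `bᵀλ + (c^max)ᵀν − (c^min)ᵀμ` subject to `λ, μ, ν ≥ 0`, `−y + Bᵀλ + ν = μ`
and `y ∈ Y`; moreover the minimum is attained. -/
theorem stmt_8 {A : Type*} [Fintype A] [Nonempty A]
    (D : A → ℕ) (hD : ∀ a, 0 < D a)
    (l u : A → ℝ) (hl0 : ∀ a, 0 ≤ l a) (hlu : ∀ a, l a ≤ u a)
    (lo hi ql qh : (a : A) → Fin (D a) → ℝ)
    (hllo : ∀ a i, l a ≤ lo a i) (hlohi : ∀ a i, lo a i ≤ hi a i) (hhiu : ∀ a i, hi a i ≤ u a)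
    (hql0 : ∀ a i, 0 ≤ ql a i) (hqlqh : ∀ a i, ql a i ≤ qh a i) (hqh1 : ∀ a i, qh a i ≤ 1)
    (hloD : ∀ a, lo a ⟨D a - 1, Nat.sub_lt (hD a) one_pos⟩ = l a)
    (hhiD : ∀ a, hi a ⟨D a - 1, Nat.sub_lt (hD a) one_pos⟩ = u a)
    (hqlD : ∀ a, ql a ⟨D a - 1, Nat.sub_lt (hD a) one_pos⟩ = 1)
    (hqhD : ∀ a, qh a ⟨D a - 1, Nat.sub_lt (hD a) one_pos⟩ = 1)
    (hne : ∀ a, (ambSet (D a) (lo a) (hi a) (ql a) (qh a)).Nonempty)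
    (hminAtt : ∀ a, ∃ Q ∈ ambSet (D a) (lo a) (hi a) (ql a) (qh a),
      (∫ x, x ∂Q) = cmin (D a) (lo a) (hi a) (ql a) (qh a))
    (hmaxAtt : ∀ a, ∃ Q ∈ ambSet (D a) (lo a) (hi a) (ql a) (qh a),
      (∫ x, x ∂Q) = cmax (D a) (lo a) (hi a) (ql a) (qh a))
    (D0 : ℕ) (B : Fin D0 → A → ℝ) (b : Fin D0 → ℝ)
    (hS : (polyS D lo hi ql qh D0 B b).Nonempty)
    (Y : Finset (A → ℝ)) (hY : Y.Nonempty)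
    (hY01 : ∀ y ∈ Y, ∀ a, y a = 0 ∨ y a = 1) :
    ∃ y ∈ Y, ∃ lam : Fin D0 → ℝ, ∃ mu nu : A → ℝ,
      mipFeas D0 B y lam mu nu ∧
      ((∑ d, b d * lam d) + (∑ a, cmax (D a) (lo a) (hi a) (ql a) (qh a) * nu a)
          - (∑ a, cmin (D a) (lo a) (hi a) (ql a) (qh a) * mu a) =
        sInf ((fun y' : A → ℝ =>
          sSup ((fun Q : Measure (A → ℝ) => ∫ c, ∑ a, c a * y' a ∂Q) ''
            ambJoint D lo hi ql qh D0 B b)) '' (Y : Set (A → ℝ)))) ∧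
      (∀ y' ∈ Y, ∀ lam' : Fin D0 → ℝ, ∀ mu' nu' : A → ℝ,
        mipFeas D0 B y' lam' mu' nu' →
        (∑ d, b d * lam d) + (∑ a, cmax (D a) (lo a) (hi a) (ql a) (qh a) * nu a)
            - (∑ a, cmin (D a) (lo a) (hi a) (ql a) (qh a) * mu a) ≤
          (∑ d, b d * lam' d) + (∑ a, cmax (D a) (lo a) (hi a) (ql a) (qh a) * nu' a)
            - (∑ a, cmin (D a) (lo a) (hi a) (ql a) (qh a) * mu' a)) := by
  let V (y : A → ℝ) : ℝ := sSup ((fun Q : Measure (A → ℝ) => ∫ c, ∑ a, c a * y a ∂Q) ''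
    ambJoint D lo hi ql qh D0 B b)
  have hV : ∀ y, V y = sSup ((fun c : A → ℝ => ∑ a, c a * y a) '' polyS D lo hi ql qh D0 B b) :=
    fun y => congrArg sSup (image_integral_ambJoint_eq hqlD hminAtt hmaxAtt D0 B b y)
  have hbound : ∀ y lam mu nu, mipFeas D0 B y lam mu nu →
      ∑ d, b d * lam d + ∑ a, cmax (D a) (lo a) (hi a) (ql a) (qh a) * nu a
        - ∑ a, cmin (D a) (lo a) (hi a) (ql a) (qh a) * mu a ∈
      upperBounds ((fun c : A → ℝ => ∑ a, c a * y a) '' polyS D lo hi ql qh D0 B b) := by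
    rintro y lam mu nu hf _ ⟨c, ⟨hc, hB⟩, rfl⟩
    exact sum_mul_le_of_mipFeas hf hc hB
  have hweak : ∀ y lam mu nu, mipFeas D0 B y lam mu nu →
      V y ≤ ∑ d, b d * lam d + ∑ a, cmax (D a) (lo a) (hi a) (ql a) (qh a) * nu a
        - ∑ a, cmin (D a) (lo a) (hi a) (ql a) (qh a) * mu a := by
    intro y lam mu nu hf
    rw [hV]
    exact csSup_le (hS.image _) (hbound y lam mu nu hf)
  have hbdd : ∀ y : A → ℝ,
      BddAbove ((fun c : A → ℝ => ∑ a, c a * y a) '' polyS D lo hi ql qh D0 B b) := fun y =>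
    ⟨_, hbound y 0 (fun a => (y a)⁻) (fun a => (y a)⁺) ⟨fun _ => le_rfl, fun _ => negPart_nonneg _,
      fun _ => posPart_nonneg _, fun a => by
        have := posPart_sub_negPart (y a)
        simp only [Pi.zero_apply, mul_zero, Finset.sum_const_zero]
        linarith⟩⟩
  obtain ⟨y, hy, hmin⟩ := Y.exists_min_image V hY
  obtain ⟨lam, mu, nu, hf, hle⟩ := exists_mipFeas_le (B := B) (b := b) (y := y) (t := V y)
    (m := fun a => cmin (D a) (lo a) (hi a) (ql a) (qh a))
    (M := fun a => cmax (D a) (lo a) (hi a) (ql a) (qh a)) fun c hc hB => by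
      rw [hV]
      exact le_csSup (hbdd y) (mem_image_of_mem _ ⟨hc, hB⟩)
  refine ⟨y, hy, lam, mu, nu, hf, ?_, fun y' hy' lam' mu' nu' hf' =>
    hle.trans ((hmin y' hy').trans (hweak _ _ _ _ hf'))⟩
  have hleast : IsLeast (V '' (Y : Set (A → ℝ))) (V y) :=
    ⟨mem_image_of_mem _ hy, by rintro _ ⟨y', hy', rfl⟩; exact hmin y' hy'⟩
  exact (le_antisymm hle (hweak _ _ _ _ hf)).trans hleast.csInf_eq.symm
end
end
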